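/- arXiv:1906.02963 — 2 statements merged into one kernel-verified Lean document; each statement's English description precedes it below -/
import Mathlib

section
/- Let (D, ⊑) be a poset. The following are equivalent: (1) for every nonempty finite set G and every map δ : G → D, the pattern setup (G, (D, ⊑), δ) is a pattern multistructure; (2) every nonempty finite subset S ⊆ D has all its multi-infima (Sˡ = ↓max(Sˡ)) and, moreover, D = ↓max(D). -/
universe u

/-- Cover operator of a pattern setup. -/
def cov {G D : Type u} [PartialOrder D] (δ : G → D) (A : Set G) : Set D :=
  {d | ∀ g ∈ A, d ≤ δ g}

/-- Downward closure of a set in a poset. -/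
def downClo {P : Type u} [PartialOrder P] (T : Set P) : Set P := {x | ∃ t ∈ T, x ≤ t}

/-- The set of maximal elements of `S`. -/
def maxSet {P : Type u} [PartialOrder P] (S : Set P) : Set P :=
  {x ∈ S | ∀ y ∈ S, x ≤ y → y = x}

theorem cov_eq_lowerBounds_image {G D : Type u} [PartialOrder D] (δ : G → D) (A : Set G) :
    cov δ A = lowerBounds (δ '' A) := by
  ext d
  simp [cov, mem_lowerBounds]

/-- `(G, (D, ⊑), δ)` is a pattern multistructure for every nonempty finite `G` and every
    `δ : G → D` iff every nonempty finite `S ⊆ D` has all its multi-infima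
    (`Sˡ = ↓max(Sˡ)`) and `D = ↓max(D)`. -/
theorem stmt_15 {D : Type u} [PartialOrder D] :
    (∀ (G : Type u), Nonempty G → Finite G → ∀ δ : G → D,
        ∀ A : Set G, cov δ A = downClo (maxSet (cov δ A))) ↔
    ((∀ S : Set D, S.Nonempty → S.Finite →
        lowerBounds S = downClo (maxSet (lowerBounds S))) ∧
      (Set.univ : Set D) = downClo (maxSet (Set.univ : Set D))) := by
  simp only [cov_eq_lowerBounds_image]
  constructor
  · intro h
    refine ⟨fun S hne hfin => ?_, ?_⟩
    · have hS := h S hne.to_subtype hfin.to_subtype Subtype.val Set.univ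
      rwa [Set.image_univ, Subtype.range_coe] at hS
    · rcases isEmpty_or_nonempty D with _ | ⟨⟨d⟩⟩
      · exact Subsingleton.elim _ _
      · have hE := h PUnit inferInstance inferInstance (fun _ => d) ∅
        rwa [Set.image_empty, lowerBounds_empty] at hE
  · rintro ⟨hS, hD⟩ G - hG δ A
    rcases A.eq_empty_or_nonempty with rfl | hA
    · rwa [Set.image_empty, lowerBounds_empty]
    · exact hS _ (hA.image δ) (A.toFinite.image δ)
end

section
/- Let (D, ⊑) be a poset. The following are equivalent: (1) for every nonempty set G and every map δ : G → D, the pattern setup (G, (D, ⊑), δ) is a pattern multistructure; (2) (D, ⊑) is a complete meet-multisemilattice, i.e., every subset S ⊆ D satisfies Sˡ = ↓max(Sˡ). -/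
universe u

/-- `(G, (D, ⊑), δ)` is a pattern multistructure for every nonempty `G` and every
    `δ : G → D` iff `D` is a complete meet-multisemilattice: every `S ⊆ D`
    satisfies `Sˡ = ↓max(Sˡ)`. -/
theorem stmt_16 {D : Type u} [PartialOrder D] :
    (∀ (G : Type u), Nonempty G → ∀ δ : G → D,
        ∀ A : Set G, cov δ A = downClo (maxSet (cov δ A))) ↔
    (∀ S : Set D, lowerBounds S = downClo (maxSet (lowerBounds S))) := by
  constructor
  · intro h S
    rcases isEmpty_or_nonempty D with _ | hD
    · exact Subsingleton.elim _ _
    · simpa only [cov_eq_lowerBounds_image, Set.image_id] using h D hD id S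
  · intro h G _ δ A
    rw [cov_eq_lowerBounds_image]
    exact h (δ '' A)
end
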